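/- arXiv:2411.00732 — 2 statements merged into one kernel-verified Lean document; each statement's English description precedes it below -/
import Mathlib

section
/- Let Z be a topological space, σ : Z → Z a map, D ⊆ Z a subset with σ(D) ⊆ D, and τ ∈ D a point such that for every z ∈ D the sequence of iterates σⁿ(z) converges to τ. Let 𝒰 be a family of subsets of Z whose union is Z such that: (a) there is a neighborhood U of τ that meets only finitely many members of 𝒰, and every member of 𝒰 that meets U has finite intersection with Z \ D; (b) every member of 𝒰 contains at least one point of D; (c) for every T ∈ 𝒰 there exists T' ∈ 𝒰 with σ(T) ⊆ T'. Then the set A := ⋃ { T ∩ (Z \ D) : T ∈ 𝒰, T ∩ U ≠ ∅ } is finite, and for every z ∈ Z there exists N ∈ ℕ such that σⁿ(z) ∈ D ∪ A for all n ≥ N. -/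
/-- If every member of a family is mapped by `σ` into a member of the family, the same holds for
every iterate of `σ`. -/
theorem exists_mem_image_iterate_subset {Z : Type*} {σ : Z → Z} {𝒰 : Set (Set Z)}
    (hinv : ∀ T ∈ 𝒰, ∃ T' ∈ 𝒰, σ '' T ⊆ T') {T : Set Z} (hT : T ∈ 𝒰) (n : ℕ) :
    ∃ T' ∈ 𝒰, σ^[n] '' T ⊆ T' := by
  induction n with
  | zero => exact ⟨T, hT, by simp⟩
  | succ n ih =>
    obtain ⟨T₁, hT₁, h₁⟩ := ih
    obtain ⟨T₂, hT₂, h₂⟩ := hinv T₁ hT₁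
    refine ⟨T₂, hT₂, ?_⟩
    rw [Function.iterate_succ', Set.image_comp]
    exact (Set.image_mono h₁).trans h₂

/-- Abstract dynamical content of Theorem 1.1: an invariant cover with good
finiteness properties yields a finite global attractor. -/
theorem stmt_0 {Z : Type*} [TopologicalSpace Z] (σ : Z → Z) (D : Set Z)
    (hD : Set.MapsTo σ D D) (τ : Z) (hτ : τ ∈ D)
    (hconv : ∀ z ∈ D, Filter.Tendsto (fun n => σ^[n] z) Filter.atTop (nhds τ))
    (𝒰 : Set (Set Z)) (hcover : ⋃₀ 𝒰 = Set.univ)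
    (U : Set Z) (hU : U ∈ nhds τ)
    (hfinU : {T ∈ 𝒰 | (T ∩ U).Nonempty}.Finite)
    (hfinD : ∀ T ∈ 𝒰, (T ∩ U).Nonempty → (T ∩ Dᶜ).Finite)
    (hpt : ∀ T ∈ 𝒰, (T ∩ D).Nonempty)
    (hinv : ∀ T ∈ 𝒰, ∃ T' ∈ 𝒰, σ '' T ⊆ T') :
    (⋃ T ∈ {T ∈ 𝒰 | (T ∩ U).Nonempty}, (T ∩ Dᶜ)).Finite ∧
      ∀ z : Z, ∃ N : ℕ, ∀ n ≥ N,
        σ^[n] z ∈ D ∪ ⋃ T ∈ {T ∈ 𝒰 | (T ∩ U).Nonempty}, (T ∩ Dᶜ) := by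
  refine ⟨hfinU.biUnion fun T hT => hfinD T hT.1 hT.2, fun z => ?_⟩
  obtain ⟨T, hT, hzT⟩ : z ∈ ⋃₀ 𝒰 := hcover ▸ Set.mem_univ z
  obtain ⟨w, hwT, hwD⟩ := hpt T hT
  obtain ⟨N, hN⟩ := Filter.eventually_atTop.1 ((hconv w hwD).eventually_mem hU)
  refine ⟨N, fun n hn => ?_⟩
  obtain ⟨T', hT', hsub⟩ := exists_mem_image_iterate_subset hinv hT n
  by_cases hzD : σ^[n] z ∈ D
  · exact Or.inl hzD
  · exact Or.inr (Set.mem_biUnion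
      ⟨hT', σ^[n] w, hsub (Set.mem_image_of_mem _ hwT), hN n hn⟩
      ⟨hsub (Set.mem_image_of_mem _ hzT), hzD⟩)
end

section
/- Let T, W, M be topological spaces, ω : T → W a continuous map, σ : T → T a map, and π : T → M, X : W → M, Y : W → M maps satisfying Y ∘ ω = π and X ∘ ω = π ∘ σ. Let S ⊆ M and let 𝒮 be a family of subsets of M such that every connected component K of Y⁻¹(S) satisfies X(K) ⊆ S' for some S' ∈ 𝒮. Then for every connected subset C ⊆ T with π(C) ⊆ S, there exists S' ∈ 𝒮 such that π(σ(C)) ⊆ S'. -/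
/-- Abstract content of Lemma 4.2. -/
theorem stmt_4 {T W M : Type*} [TopologicalSpace T] [TopologicalSpace W]
    [TopologicalSpace M] (ω : T → W) (hω : Continuous ω) (σ : T → T)
    (π : T → M) (X Y : W → M) (h1 : Y ∘ ω = π) (h2 : X ∘ ω = π ∘ σ)
    (S : Set M) (𝒮 : Set (Set M))
    (hcomp : ∀ w ∈ Y ⁻¹' S, ∃ S' ∈ 𝒮, X '' connectedComponentIn (Y ⁻¹' S) w ⊆ S') :
    ∀ C : Set T, IsConnected C → π '' C ⊆ S →
      ∃ S' ∈ 𝒮, π '' (σ '' C) ⊆ S' := by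
  intro C hC hCS
  obtain ⟨c, hc⟩ := hC.nonempty
  have hsub : ω '' C ⊆ Y ⁻¹' S := by
    rwa [← Set.image_subset_iff, ← Set.image_comp, h1]
  obtain ⟨S', hS', hX⟩ := hcomp (ω c) (hsub (Set.mem_image_of_mem ω hc))
  refine ⟨S', hS', ?_⟩
  rw [← Set.image_comp, ← h2, Set.image_comp]
  exact (Set.image_mono ((hC.isPreconnected.image ω hω.continuousOn).subset_connectedComponentIn
    (Set.mem_image_of_mem ω hc) hsub)).trans hX
end
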